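/- Fix θ ∈ (0,1) and q = Θ(n^{2(θ−1)}), let G ~ ER(n,q) with k̄ = q·C(n,2), and let Bernoulli(p) testing use p = √(2ν/(q n²)) for a fixed constant ν > 0. Define d_max = 2nq if θ > 1/2 and d_max = log n if θ ≤ 1/2. Then there exists a sequence ε_n → 0 such that, with probability tending to 1 as n → ∞, the random graph G simultaneously satisfies: (i) (1−ε_n)·k̄ ≤ |E(G)| ≤ (1+ε_n)·k̄; (ii) the maximum degree of G is at most d_max; and (iii) (1−ε_n)·(1−e^{−ν}) ≤ P_G[Y=1] ≤ (1+ε_n)·(1−e^{−ν}). -/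

import Mathlib

open scoped BigOperators Classical
open Finset Filter

noncomputable section

/-- The set of all potential edges: unordered pairs of distinct nodes of `Fin n`. -/
def allPairs (n : ℕ) : Finset (Sym2 (Fin n)) :=
  Finset.univ.filter fun e => ¬ e.IsDiag

/-- Both endpoints of the pair `e` lie in the test `L`. -/
def pairIn {n : ℕ} (e : Sym2 (Fin n)) (L : Finset (Fin n)) : Prop :=
  ∀ v ∈ e, v ∈ L

/-- The test `L` covers some edge of the edge set `E` (positive outcome `Y = 1`). -/
def covers {n : ℕ} (E : Finset (Sym2 (Fin n))) (L : Finset (Fin n)) : Prop :=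
  ∃ e ∈ E, pairIn e L

/-- ER(n,q) probability weight of a given edge set `E`. -/
def erWeight (n : ℕ) (q : ℝ) (E : Finset (Sym2 (Fin n))) : ℝ :=
  q ^ E.card * (1 - q) ^ ((allPairs n).card - E.card)

/-- Probability of an event under the Erdős–Rényi random graph ER(n,q). -/
def erProb (n : ℕ) (q : ℝ) (A : Finset (Sym2 (Fin n)) → Prop) : ℝ :=
  ∑ E ∈ (allPairs n).powerset, if A E then erWeight n q E else 0

/-- Bernoulli(p) probability weight of a single test `L ⊆ {1,…,n}`. -/
def testWeight (n : ℕ) (p : ℝ) (L : Finset (Fin n)) : ℝ :=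
  p ^ L.card * (1 - p) ^ (n - L.card)

/-- Probability of an event for a single Bernoulli(p) test. -/
def bernProb (n : ℕ) (p : ℝ) (A : Finset (Fin n) → Prop) : ℝ :=
  ∑ L : Finset (Fin n), if A L then testWeight n p L else 0

/-- Probability weight of `t` i.i.d. Bernoulli(p) tests. -/
def testsWeight (n t : ℕ) (p : ℝ) (Ls : Fin t → Finset (Fin n)) : ℝ :=
  ∏ i, testWeight n p (Ls i)

/-- Probability of an event for `t` i.i.d. Bernoulli(p) tests. -/
def bernTestsProb (n t : ℕ) (p : ℝ) (A : (Fin t → Finset (Fin n)) → Prop) : ℝ :=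
  ∑ Ls : Fin t → Finset (Fin n), if A Ls then testsWeight n t p Ls else 0

/-- Joint probability over an ER(n,q) graph and `t` i.i.d. Bernoulli(p) tests. -/
def erTestsProb (n t : ℕ) (q p : ℝ)
    (A : Finset (Sym2 (Fin n)) → (Fin t → Finset (Fin n)) → Prop) : ℝ :=
  ∑ E ∈ (allPairs n).powerset, ∑ Ls : Fin t → Finset (Fin n),
    if A E Ls then erWeight n q E * testsWeight n t p Ls else 0

/-- Degree of node `v` in the edge set `E`. -/
def degOf {n : ℕ} (E : Finset (Sym2 (Fin n))) (v : Fin n) : ℕ :=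
  (E.filter fun e => v ∈ e).card

/-- Maximum degree of the edge set `E`. -/
def maxDeg {n : ℕ} (E : Finset (Sym2 (Fin n))) : ℕ :=
  Finset.univ.sup (degOf E)

/-- Average number of edges of ER(n, q n): `k̄ = q·C(n,2)`. -/
def kbar (q : ℕ → ℝ) (n : ℕ) : ℝ := q n * (n.choose 2 : ℝ)

/-- Two pairs are vertex-disjoint. -/
def sym2Disjoint {n : ℕ} (e e' : Sym2 (Fin n)) : Prop := ∀ v, v ∈ e → v ∉ e'

section subsetExp

/-- Expectation of `f` over a random subset of `S` that contains each element independently with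
probability `p`. -/
def subsetExp {α : Type*} (S : Finset α) (p : ℝ) (f : Finset α → ℝ) : ℝ :=
  ∑ E ∈ S.powerset, f E * (p ^ #E * (1 - p) ^ (#S - #E))

variable {α : Type*} {S : Finset α} {p : ℝ}

lemma subsetExp_add (f g : Finset α → ℝ) :
    subsetExp S p (fun E => f E + g E) = subsetExp S p f + subsetExp S p g := by
  simp [subsetExp, add_mul, sum_add_distrib]

lemma subsetExp_const_mul (c : ℝ) (f : Finset α → ℝ) :
    subsetExp S p (fun E => c * f E) = c * subsetExp S p f := by
  simp [subsetExp, mul_sum, mul_assoc]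

lemma subsetExp_sum {ι : Type*} (T : Finset ι) (f : ι → Finset α → ℝ) :
    subsetExp S p (fun E => ∑ i ∈ T, f i E) = ∑ i ∈ T, subsetExp S p (f i) := by
  simp only [subsetExp, sum_mul]
  exact sum_comm

lemma subsetExp_prod (x y : α → ℝ) :
    subsetExp S p (fun E => (∏ i ∈ E, x i) * ∏ i ∈ S \ E, y i) =
      ∏ i ∈ S, (x i * p + y i * (1 - p)) := by
  rw [prod_add, subsetExp]
  refine sum_congr rfl fun E hE => ?_
  rw [prod_mul_distrib, prod_mul_distrib, prod_const, prod_const,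
    card_sdiff_of_subset (mem_powerset.1 hE)]
  ring

lemma subsetExp_const (c : ℝ) : subsetExp S p (fun _ => c) = c := by
  have h := subsetExp_prod (S := S) (p := p) (fun _ => 1) (fun _ => 1)
  simp only [prod_const_one, one_mul, add_sub_cancel] at h
  simpa [h] using subsetExp_const_mul (S := S) (p := p) c (fun _ => 1)

lemma subsetExp_mono (hp0 : 0 ≤ p) (hp1 : p ≤ 1) {f g : Finset α → ℝ}
    (h : ∀ E ⊆ S, f E ≤ g E) : subsetExp S p f ≤ subsetExp S p g := by
  refine sum_le_sum fun E hE => mul_le_mul_of_nonneg_right (h E (mem_powerset.1 hE)) ?_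
  have := sub_nonneg.2 hp1
  positivity

lemma subsetExp_congr {f g : Finset α → ℝ} (h : ∀ E ⊆ S, f E = g E) :
    subsetExp S p f = subsetExp S p g :=
  sum_congr rfl fun E hE => by rw [h E (mem_powerset.1 hE)]

lemma abs_subsetExp_le (hp0 : 0 ≤ p) (hp1 : p ≤ 1) (f : Finset α → ℝ) :
    |subsetExp S p f| ≤ subsetExp S p fun E => |f E| := by
  refine (abs_sum_le_sum_abs _ _).trans (sum_le_sum fun E _ => ?_)
  have := sub_nonneg.2 hp1
  rw [abs_mul, abs_of_nonneg (show 0 ≤ p ^ #E * (1 - p) ^ (#S - #E) by positivity)]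

lemma subsetExp_comm {β : Type*} {T : Finset β} {r : ℝ} (f : Finset α → Finset β → ℝ) :
    subsetExp S p (fun E => subsetExp T r (f E)) =
      subsetExp T r (fun L => subsetExp S p fun E => f E L) := by
  simp only [subsetExp, sum_mul]
  rw [sum_comm]
  exact sum_congr rfl fun _ _ => sum_congr rfl fun _ _ => by ring

lemma subsetExp_mul_subsetExp {β : Type*} {T : Finset β} {r : ℝ} (f : Finset α → ℝ)
    (g : Finset β → ℝ) : subsetExp S p f * subsetExp T r g =
      subsetExp S p (fun E => subsetExp T r fun L => f E * g L) := by
  simp only [subsetExp_const_mul]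
  rw [mul_comm, ← subsetExp_const_mul]
  simp only [mul_comm]

lemma subsetExp_sq_sub (a : ℝ) (f : Finset α → ℝ) :
    subsetExp S p (fun E => (f E - a) ^ 2) =
      subsetExp S p (fun E => f E ^ 2) - subsetExp S p f ^ 2 + (subsetExp S p f - a) ^ 2 := by
  have h : subsetExp S p (fun E => (f E - a) ^ 2) =
      subsetExp S p (fun E => f E ^ 2) + (-(2 * a) * subsetExp S p f + a ^ 2) := by
    conv_rhs => rw [← subsetExp_const_mul, ← subsetExp_const (S := S) (p := p) (a ^ 2),
      ← subsetExp_add, ← subsetExp_add]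
    exact subsetExp_congr fun E _ => by ring
  rw [h]
  ring

/-- The variance of the size of a random subset. -/
lemma subsetExp_card_variance :
    subsetExp S p (fun E => ((#E : ℝ) - #S * p) ^ 2) = #S * p * (1 - p) := by
  have h := congrArg (Polynomial.eval p) (bernsteinPolynomial.variance ℝ #S)
  simp only [Polynomial.eval_finsetSum, bernsteinPolynomial] at h
  simp only [nsmul_eq_mul, Polynomial.eval_mul, Polynomial.eval_pow, Polynomial.eval_sub,
    Polynomial.eval_natCast, Polynomial.eval_X, Polynomial.eval_one] at h
  rw [← h, subsetExp, sum_powerset_apply_card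
    (fun k => ((k : ℝ) - #S * p) ^ 2 * (p ^ k * (1 - p) ^ (#S - k)))]
  refine sum_congr rfl fun k _ => ?_
  rw [nsmul_eq_mul]
  ring

/-- The probability that a random subset avoids `T`. -/
lemma subsetExp_disjoint {T : Finset α} [∀ E, Decidable (Disjoint E T)] (hT : T ⊆ S) :
    subsetExp S p (fun E => if Disjoint E T then 1 else 0) = (1 - p) ^ #T := by
  have h := subsetExp_prod (S := S) (p := p) (fun i => if i ∈ T then 0 else 1) (fun _ => 1)
  have h2 : ∏ i ∈ S, ((if i ∈ T then 0 else 1) * p + 1 * (1 - p)) = (1 - p) ^ #T := by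
    rw [← prod_subset hT fun i _ hi => by simp [hi], ← prod_const]
    exact prod_congr rfl fun i hi => by simp [hi]
  rw [← h2, ← h]
  refine subsetExp_congr fun E _ => ?_
  rw [prod_const_one, mul_one]
  by_cases hd : Disjoint E T
  · rw [if_pos hd, prod_eq_one fun i hi => if_neg (disjoint_left.1 hd hi)]
  · obtain ⟨i, hi, hiT⟩ := not_disjoint_iff.1 hd
    rw [if_neg hd]
    symm
    exact prod_eq_zero hi (if_pos hiT)

/-- The probability that a random subset contains `T`. -/
lemma subsetExp_superset {T : Finset α} [∀ E, Decidable (T ⊆ E)] (hT : T ⊆ S) :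
    subsetExp S p (fun E => if T ⊆ E then 1 else 0) = p ^ #T := by
  have h := subsetExp_prod (S := S) (p := p) (fun _ => 1) (fun i => if i ∈ T then 0 else 1)
  have h2 : ∏ i ∈ S, (1 * p + (if i ∈ T then 0 else 1) * (1 - p)) = p ^ #T := by
    rw [← prod_subset hT fun i _ hi => by simp [hi], ← prod_const]
    exact prod_congr rfl fun i hi => by simp [hi]
  rw [← h2, ← h]
  refine subsetExp_congr fun E _ => ?_
  rw [prod_const_one, one_mul]
  by_cases hd : T ⊆ E
  · rw [if_pos hd, prod_eq_one fun i hi => if_neg fun hiT => (mem_sdiff.1 hi).2 (hd hiT)]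
  · obtain ⟨i, hiT, hi⟩ := not_subset.1 hd
    rw [if_neg hd]
    symm
    exact prod_eq_zero (mem_sdiff.2 ⟨hT hiT, hi⟩) (if_pos hiT)

/-- The moment generating function of the number of chosen elements satisfying `P`. -/
lemma subsetExp_exp_card_filter_le (hp0 : 0 ≤ p) (P : α → Prop) [DecidablePred P] {t : ℝ}
    (ht : 0 ≤ t) :
    subsetExp S p (fun E => Real.exp (t * #(E.filter P))) ≤
      Real.exp (p * (Real.exp t - 1) * #(S.filter P)) := by
  have h := subsetExp_prod (S := S) (p := p) (fun i => if P i then Real.exp t else 1) (fun _ => 1)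
  have h1 : subsetExp S p (fun E => Real.exp (t * #(E.filter P))) =
      ∏ i ∈ S, ((if P i then Real.exp t else 1) * p + 1 * (1 - p)) := by
    rw [← h]
    refine subsetExp_congr fun E _ => ?_
    rw [prod_const_one, mul_one, prod_ite, prod_const_one, mul_one, prod_const, mul_comm,
      Real.exp_nat_mul]
  have het : 0 ≤ Real.exp t - 1 := sub_nonneg.2 (Real.one_le_exp ht)
  have h2 : Real.exp (p * (Real.exp t - 1) * #(S.filter P)) =
      ∏ i ∈ S, (if P i then Real.exp (p * (Real.exp t - 1)) else 1) := by
    rw [prod_ite, prod_const_one, mul_one, prod_const, mul_comm, Real.exp_nat_mul]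
  rw [h1, h2]
  refine prod_le_prod (fun i _ => ?_) fun i _ => ?_
  · split_ifs <;> nlinarith [mul_nonneg het hp0]
  · split_ifs
    · nlinarith [Real.add_one_le_exp (p * (Real.exp t - 1))]
    · linarith

end subsetExp

/-- The pairs with both endpoints in `L`. -/
def inducedPairs {n : ℕ} (L : Finset (Fin n)) : Finset (Sym2 (Fin n)) :=
  (allPairs n).filter fun e => pairIn e L

lemma mem_allPairs {n : ℕ} {e : Sym2 (Fin n)} : e ∈ allPairs n ↔ ¬ e.IsDiag := by
  simp [allPairs]

lemma mem_inducedPairs {n : ℕ} {e : Sym2 (Fin n)} {L : Finset (Fin n)} :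
    e ∈ inducedPairs L ↔ e ∈ allPairs n ∧ pairIn e L :=
  mem_filter

lemma inducedPairs_subset {n : ℕ} (L : Finset (Fin n)) : inducedPairs L ⊆ allPairs n :=
  filter_subset _ _

lemma card_inducedPairs {n : ℕ} (L : Finset (Fin n)) : #(inducedPairs L) = (#L).choose 2 := by
  rw [← Sym2.card_image_offDiag]
  congr 1
  ext e
  induction e with
  | _ a b =>
    simp only [mem_inducedPairs, mem_allPairs, pairIn, mem_image, mem_offDiag,
      Sym2.mk_isDiag_iff, Sym2.mem_iff, Prod.exists, Function.uncurry_apply_pair, Sym2.eq_iff]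
    constructor
    · rintro ⟨hab, h⟩
      exact ⟨a, b, ⟨h a (Or.inl rfl), h b (Or.inr rfl), hab⟩, Or.inl ⟨rfl, rfl⟩⟩
    · grind

lemma card_allPairs (n : ℕ) : #(allPairs n) = n.choose 2 := by
  have h := card_inducedPairs (univ : Finset (Fin n))
  rw [card_univ, Fintype.card_fin] at h
  rw [← h, inducedPairs, filter_true_of_mem]
  simp [pairIn]

lemma erProb_eq_subsetExp (n : ℕ) (q : ℝ) (A : Finset (Sym2 (Fin n)) → Prop) :
    erProb n q A = subsetExp (allPairs n) q (fun E => if A E then 1 else 0) := by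
  simp [erProb, subsetExp, erWeight]

lemma bernProb_eq_subsetExp (n : ℕ) (p : ℝ) (A : Finset (Fin n) → Prop) :
    bernProb n p A = subsetExp univ p (fun L => if A L then 1 else 0) := by
  simp [bernProb, subsetExp, testWeight]

/-- The probability that a Bernoulli(`p`) test contains no edge of `E`. -/
def missProb (n : ℕ) (p : ℝ) (E : Finset (Sym2 (Fin n))) : ℝ :=
  subsetExp univ p fun L => if Disjoint E (inducedPairs L) then 1 else 0

lemma bernProb_covers (n : ℕ) (p : ℝ) {E : Finset (Sym2 (Fin n))} (hE : E ⊆ allPairs n) :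
    bernProb n p (covers E) = 1 - missProb n p E := by
  rw [eq_sub_iff_add_eq, bernProb_eq_subsetExp, missProb, ← subsetExp_add,
    ← subsetExp_const (S := (univ : Finset (Fin n))) (p := p) 1]
  refine subsetExp_congr fun L _ => ?_
  have h : covers E L ↔ ¬ Disjoint E (inducedPairs L) := by
    rw [not_disjoint_iff]
    exact exists_congr fun e => and_congr_right fun he => by simp [mem_inducedPairs, hE he]
  by_cases hd : Disjoint E (inducedPairs L) <;> simp [h, hd, subsetExp_const]

lemma subsetExp_missProb (n : ℕ) (q p : ℝ) :
    subsetExp (allPairs n) q (missProb n p) =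
      subsetExp (univ : Finset (Fin n)) p fun L => (1 - q) ^ (#L).choose 2 := by
  unfold missProb
  rw [subsetExp_comm]
  refine subsetExp_congr fun L _ => ?_
  rw [subsetExp_disjoint (inducedPairs_subset L), card_inducedPairs]

lemma subsetExp_missProb_sq (n : ℕ) (q p : ℝ) :
    subsetExp (allPairs n) q (fun E => missProb n p E ^ 2) =
      subsetExp (univ : Finset (Fin n)) p fun L => subsetExp (univ : Finset (Fin n)) p fun L' =>
        (1 - q) ^ #(inducedPairs L ∪ inducedPairs L') := by
  simp only [missProb, sq, subsetExp_mul_subsetExp]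
  rw [subsetExp_comm]
  refine subsetExp_congr fun L _ => ?_
  rw [subsetExp_comm]
  refine subsetExp_congr fun L' _ => ?_
  rw [← subsetExp_disjoint (union_subset (inducedPairs_subset L) (inducedPairs_subset L'))]
  refine subsetExp_congr fun E _ => ?_
  simp only [disjoint_union_right, ite_and]
  split_ifs <;> simp

lemma subsetExp_mem_inducedPairs {n : ℕ} (p : ℝ) {e : Sym2 (Fin n)} (he : e ∈ allPairs n) :
    subsetExp (univ : Finset (Fin n)) p (fun L => if e ∈ inducedPairs L then 1 else 0) =
      p ^ 2 := by
  have hcard : #e.toFinset = 2 := Sym2.card_toFinset_of_not_isDiag e (mem_allPairs.1 he)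
  rw [← hcard, ← subsetExp_superset (subset_univ _)]
  refine subsetExp_congr fun L _ => ?_
  simp [mem_inducedPairs, he, pairIn, subset_iff]

lemma subsetExp_card_inter_inducedPairs (n : ℕ) (p : ℝ) :
    subsetExp (univ : Finset (Fin n)) p (fun L => subsetExp (univ : Finset (Fin n)) p fun L' =>
      (#(inducedPairs L ∩ inducedPairs L') : ℝ)) = n.choose 2 * p ^ 4 := by
  have h (L L' : Finset (Fin n)) : (#(inducedPairs L ∩ inducedPairs L') : ℝ) =
      ∑ e ∈ allPairs n, (if e ∈ inducedPairs L then 1 else 0) *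
        (if e ∈ inducedPairs L' then 1 else 0) := by
    simp only [← ite_and, ← sum_filter, mul_ite, mul_one, mul_zero, card_eq_sum_ones,
      Nat.cast_sum, Nat.cast_one]
    refine sum_congr ?_ fun _ _ => rfl
    ext e
    simp only [mem_inter, mem_filter, mem_inducedPairs]
    tauto
  simp only [h, subsetExp_sum]
  simp only [← subsetExp_mul_subsetExp]
  rw [sum_congr rfl fun e he => by rw [subsetExp_mem_inducedPairs p he], sum_const, card_allPairs,
    nsmul_eq_mul]
  ring

/-- The probability that a test misses the random graph has a small variance. -/
lemma subsetExp_missProb_sq_le (n : ℕ) {q p : ℝ} (hq0 : 0 ≤ q) (hq1 : q ≤ 1) (hp0 : 0 ≤ p)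
    (hp1 : p ≤ 1) :
    subsetExp (allPairs n) q (fun E => missProb n p E ^ 2) ≤
      subsetExp (allPairs n) q (missProb n p) ^ 2 + q * (n.choose 2 * p ^ 4) := by
  rw [subsetExp_missProb_sq, subsetExp_missProb, sq, subsetExp_mul_subsetExp,
    ← subsetExp_card_inter_inducedPairs, ← subsetExp_const_mul, ← subsetExp_add]
  refine subsetExp_mono hp0 hp1 fun L _ => ?_
  rw [← subsetExp_const_mul, ← subsetExp_add]
  refine subsetExp_mono hp0 hp1 fun L' _ => ?_
  rw [← card_inducedPairs, ← card_inducedPairs, ← pow_add, ← card_union_add_card_inter, pow_add]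
  have h1 : (1 - q) ^ #(inducedPairs L ∪ inducedPairs L') ≤ 1 :=
    pow_le_one₀ (by linarith) (by linarith)
  have h0 : 0 ≤ (1 - q) ^ #(inducedPairs L ∪ inducedPairs L') := pow_nonneg (by linarith) _
  have h2 := one_add_mul_le_pow (a := -q) (by linarith) #(inducedPairs L ∩ inducedPairs L')
  rw [← sub_eq_add_neg] at h2
  have h3 : 0 ≤ q * #(inducedPairs L ∩ inducedPairs L') := by positivity
  nlinarith [mul_nonneg h3 (sub_nonneg.2 h1), mul_le_mul_of_nonneg_left h2 h0]

/-- The expected exponential moment of a degree. -/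
lemma subsetExp_exp_degOf_le {n : ℕ} {q : ℝ} (hq0 : 0 ≤ q) (v : Fin n) {t : ℝ} (ht : 0 ≤ t) :
    subsetExp (allPairs n) q (fun E => Real.exp (t * degOf E v)) ≤
      Real.exp (q * (Real.exp t - 1) * n) := by
  refine (subsetExp_exp_card_filter_le hq0 (fun e => v ∈ e) ht).trans (Real.exp_le_exp.2 ?_)
  have het : 0 ≤ Real.exp t - 1 := sub_nonneg.2 (Real.one_le_exp ht)
  refine mul_le_mul_of_nonneg_left ?_ (mul_nonneg hq0 het)
  have hsub : (allPairs n).filter (fun e => v ∈ e) ⊆ univ.image fun w => s(v, w) := by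
    intro e he
    obtain ⟨w, rfl⟩ := (mem_filter.1 he).2
    exact mem_image_of_mem _ (mem_univ w)
  have := (card_le_card hsub).trans card_image_le
  rw [card_univ, Fintype.card_fin] at this
  exact_mod_cast this

/-- The mean probability of a negative test, for tests with `s ^ 2` nodes on average. -/
lemma abs_subsetExp_missProb_sub_le {n : ℕ} {q p ν s : ℝ} (hq0 : 0 ≤ q) (hq1 : q ≤ 1)
    (hp0 : 0 ≤ p) (hp1 : p ≤ 1) (hs : 1 ≤ s) (hμ : n * p = s ^ 2) (hν : q * s ^ 4 = 2 * ν) :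
    |subsetExp (allPairs n) q (missProb n p) - Real.exp (-ν)| ≤ 10 * ν / s + q * ν := by
  have hν0 : 0 ≤ ν := by
    have : 0 ≤ q * s ^ 4 := by positivity
    linarith
  have hs0 : 0 < s := by linarith
  have hexp : |Real.exp (-q) - (1 - q)| ≤ q ^ 2 := by
    have := Real.abs_exp_sub_one_sub_id_le (x := -q) (by rwa [abs_neg, abs_of_nonneg hq0])
    rw [show Real.exp (-q) - (1 - q) = Real.exp (-q) - 1 - -q by ring]
    simpa using this
  have hpt (k : ℕ) : |(1 - q) ^ k.choose 2 - Real.exp (-ν)| ≤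
      q * (1 + (2 * s ^ 2 + 1) / (2 * s)) * (k - s ^ 2) ^ 2 +
        (q * (s ^ 2 + (2 * s ^ 2 + 1) * s / 2) + q * ν) := by
    have hchoose : ((k.choose 2 : ℕ) : ℝ) = k * (k - 1) / 2 := Nat.cast_choose_two ℝ k
    set m : ℕ := k.choose 2
    have h1 : |(1 - q) ^ m - Real.exp (-(q * m))| ≤ q ^ 2 * m := by
      have he : Real.exp (-(q * m)) = Real.exp (-q) ^ m := by
        rw [← Real.exp_nat_mul]; ring_nf
      rw [he]
      refine (abs_pow_sub_pow_le _ _ _).trans ?_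
      have hmax : max |1 - q| |Real.exp (-q)| ^ (m - 1) ≤ 1 := by
        refine pow_le_one₀ (le_max_of_le_left (abs_nonneg _)) (max_le ?_ ?_)
        · rw [abs_of_nonneg] <;> linarith
        · rw [Real.abs_exp]; exact Real.exp_le_one_iff.2 (by linarith)
      rw [abs_sub_comm]
      calc _ ≤ q ^ 2 * m * 1 := by gcongr
        _ = _ := mul_one _
    have h2 : |Real.exp (-(q * m)) - Real.exp (-ν)| ≤ |q * m - ν| := by
      have key (a b : ℝ) (ha : 0 ≤ a) (hb : 0 ≤ b) :
          Real.exp (-a) - Real.exp (-b) ≤ |a - b| := by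
        have h3 := Real.add_one_le_exp (a - b)
        have h4 : Real.exp (-b) = Real.exp (-a) * Real.exp (a - b) := by
          rw [← Real.exp_add]; ring_nf
        have h5 : Real.exp (-a) ≤ 1 := Real.exp_le_one_iff.2 (by linarith)
        have h6 := Real.exp_pos (-a)
        rw [h4]
        have h7 := neg_abs_le (a - b)
        nlinarith [mul_le_mul_of_nonneg_left h3 h6.le, abs_nonneg (a - b),
          mul_le_mul_of_nonneg_left h7 h6.le, mul_le_mul_of_nonneg_right h5 (abs_nonneg (a - b))]
      have hqm : 0 ≤ q * m := by positivity
      exact abs_le.2 ⟨by have := key ν (q * m) hν0 hqm; rw [abs_sub_comm] at this; linarith,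
        key _ _ hqm hν0⟩
    have h3 : |q * m - ν| ≤ q / 2 * ((k - s ^ 2) ^ 2 + (2 * s ^ 2 + 1) * |k - s ^ 2| + s ^ 2) := by
      have : q * m - ν = q / 2 * ((k - s ^ 2) ^ 2 + (2 * s ^ 2 - 1) * (k - s ^ 2) - s ^ 2) := by
        rw [hchoose]; linear_combination (1 / 2) * hν
      rw [this, abs_mul, abs_of_nonneg (by positivity : 0 ≤ q / 2)]
      refine mul_le_mul_of_nonneg_left ?_ (by positivity)
      have h4 := abs_nonneg ((k : ℝ) - s ^ 2)
      have h5 := le_abs_self ((k : ℝ) - s ^ 2)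
      have h6 := neg_abs_le ((k : ℝ) - s ^ 2)
      have h7 : (0 : ℝ) ≤ 2 * s ^ 2 - 1 := by nlinarith
      have h8 := mul_le_mul_of_nonneg_left h5 h7
      have h9 := mul_le_mul_of_nonneg_left h6 h7
      rw [abs_le]
      constructor <;> nlinarith
    have h4 : |(k : ℝ) - s ^ 2| ≤ (s + (k - s ^ 2) ^ 2 / s) / 2 := by
      rw [← sq_abs ((k : ℝ) - s ^ 2)]
      set d := |(k : ℝ) - s ^ 2|
      have : (s + d ^ 2 / s) / 2 - d = (s - d) ^ 2 / (2 * s) := by field_simp; ring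
      have h5 : 0 ≤ (s - d) ^ 2 / (2 * s) := by positivity
      linarith
    have h5 : q ^ 2 * m ≤ |q * m - ν| + q * ν := by
      have h6 := le_abs_self (q * m - ν)
      have h7 := abs_nonneg (q * m - ν)
      nlinarith [mul_le_mul_of_nonneg_left h6 hq0, mul_le_mul_of_nonneg_right hq1 h7]
    calc _ ≤ q ^ 2 * m + |q * m - ν| := (abs_sub_le _ _ _).trans (add_le_add h1 h2)
      _ ≤ 2 * |q * m - ν| + q * ν := by linarith
      _ ≤ 2 * (q / 2 * ((k - s ^ 2) ^ 2 + (2 * s ^ 2 + 1) * ((s + (k - s ^ 2) ^ 2 / s) / 2)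
            + s ^ 2)) + q * ν := by
          refine add_le_add (mul_le_mul_of_nonneg_left (h3.trans ?_) zero_le_two) le_rfl
          gcongr
      _ = _ := by field_simp; ring
  have hvar : subsetExp (univ : Finset (Fin n)) p (fun L => ((#L : ℝ) - s ^ 2) ^ 2) ≤ s ^ 2 := by
    have := subsetExp_card_variance (S := (univ : Finset (Fin n))) (p := p)
    rw [card_univ, Fintype.card_fin, hμ] at this
    rw [this]
    nlinarith [sq_nonneg s]
  have hsplit : subsetExp (allPairs n) q (missProb n p) - Real.exp (-ν) =
      subsetExp (univ : Finset (Fin n)) p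
        (fun L => (1 - q) ^ (#L).choose 2 - Real.exp (-ν)) := by
    simp only [sub_eq_add_neg _ (Real.exp (-ν))]
    rw [subsetExp_add, subsetExp_const, subsetExp_missProb]
  rw [hsplit]
  calc _ ≤ _ := abs_subsetExp_le hp0 hp1 _
    _ ≤ _ := subsetExp_mono hp0 hp1 fun L _ => hpt #L
    _ = q * (1 + (2 * s ^ 2 + 1) / (2 * s)) *
          subsetExp (univ : Finset (Fin n)) p (fun L => ((#L : ℝ) - s ^ 2) ^ 2) +
        (q * (s ^ 2 + (2 * s ^ 2 + 1) * s / 2) + q * ν) := by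
      rw [subsetExp_add, subsetExp_const_mul, subsetExp_const]
    _ ≤ q * (1 + (2 * s ^ 2 + 1) / (2 * s)) * s ^ 2 +
        (q * (s ^ 2 + (2 * s ^ 2 + 1) * s / 2) + q * ν) := by gcongr
    _ = q * (2 * s ^ 2 + (2 * s ^ 2 + 1) * s) + q * ν := by field_simp; ring
    _ ≤ q * (5 * s ^ 3) + q * ν := by
      gcongr
      nlinarith [mul_nonneg (sub_nonneg.2 hs) (sq_nonneg s), mul_nonneg (sub_nonneg.2 hs) hs0.le]
    _ = 10 * ν / s + q * ν := by
      have : 10 * ν = 5 * (q * s ^ 4) := by rw [hν]; ring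
      rw [this]
      field_simp

lemma erProb_mono {n : ℕ} {q : ℝ} (hq0 : 0 ≤ q) (hq1 : q ≤ 1)
    {A B : Finset (Sym2 (Fin n)) → Prop} (h : ∀ E ⊆ allPairs n, A E → B E) :
    erProb n q A ≤ erProb n q B := by
  rw [erProb_eq_subsetExp, erProb_eq_subsetExp]
  refine subsetExp_mono hq0 hq1 fun E hE => ?_
  by_cases hA : A E
  · rw [if_pos hA, if_pos (h E hE hA)]
  · rw [if_neg hA]
    split_ifs <;> norm_num

lemma erProb_le_one {n : ℕ} {q : ℝ} (hq0 : 0 ≤ q) (hq1 : q ≤ 1)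
    (A : Finset (Sym2 (Fin n)) → Prop) : erProb n q A ≤ 1 := by
  rw [erProb_eq_subsetExp, ← subsetExp_const (S := allPairs n) (p := q) 1]
  refine subsetExp_mono hq0 hq1 fun E _ => ?_
  rw [subsetExp_const]
  split_ifs <;> norm_num

/-- A union bound for the typicality event, from the second moments of the number of edges and of
the miss probability and from an exponential moment of the degrees. -/
lemma one_sub_le_erProb_typical {n : ℕ} {q p a d t δ₁ δ₂ V : ℝ} (hq0 : 0 ≤ q) (hq1 : q ≤ 1)
    (ht : 0 ≤ t) (hd : 0 ≤ d) (hδ₁ : 0 < δ₁) (hδ₂ : 0 < δ₂)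
    (hV : subsetExp (allPairs n) q (fun E => (missProb n p E - a) ^ 2) ≤ V) :
    1 - (q * n.choose 2 / δ₁ ^ 2 +
        n * (Real.exp (q * (Real.exp t - 1) * n) * Real.exp (-(t * d))) + V / δ₂ ^ 2) ≤
      erProb n q (fun E => |(#E : ℝ) - q * n.choose 2| ≤ δ₁ ∧ (maxDeg E : ℝ) ≤ d ∧
        |missProb n p E - a| ≤ δ₂) := by
  set W : Finset (Sym2 (Fin n)) → ℝ := fun E =>
    (1 / δ₁ ^ 2 * ((#E : ℝ) - #(allPairs n) * q) ^ 2 +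
      ∑ v : Fin n, Real.exp (-(t * d)) * Real.exp (t * degOf E v)) +
      1 / δ₂ ^ 2 * (missProb n p E - a) ^ 2 with hW
  have hEW : subsetExp (allPairs n) q W ≤ q * n.choose 2 / δ₁ ^ 2 +
      n * (Real.exp (q * (Real.exp t - 1) * n) * Real.exp (-(t * d))) + V / δ₂ ^ 2 := by
    rw [hW, subsetExp_add, subsetExp_add, subsetExp_const_mul, subsetExp_const_mul, subsetExp_sum,
      subsetExp_card_variance, card_allPairs]
    refine add_le_add (add_le_add ?_ ?_) ?_
    · rw [one_div_mul_eq_div]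
      refine div_le_div_of_nonneg_right ?_ (by positivity)
      nlinarith [mul_nonneg (Nat.cast_nonneg (α := ℝ) (n.choose 2)) hq0]
    · calc _ ≤ ∑ _v : Fin n, Real.exp (-(t * d)) * Real.exp (q * (Real.exp t - 1) * n) := by
            refine sum_le_sum fun v _ => ?_
            rw [subsetExp_const_mul]
            exact mul_le_mul_of_nonneg_left (subsetExp_exp_degOf_le hq0 v ht) (Real.exp_pos _).le
        _ = _ := by
            rw [sum_const, card_univ, Fintype.card_fin, nsmul_eq_mul]
            ring
    · rw [one_div_mul_eq_div]
      gcongr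
  have hcheb {x δ : ℝ} (hδ : 0 < δ) (hx : δ < |x|) : 1 ≤ 1 / δ ^ 2 * x ^ 2 := by
    rw [one_div_mul_eq_div, one_le_div (by positivity), ← sq_abs x]
    gcongr
  have hle : 1 ≤ erProb n q (fun E => |(#E : ℝ) - q * n.choose 2| ≤ δ₁ ∧ (maxDeg E : ℝ) ≤ d ∧
      |missProb n p E - a| ≤ δ₂) + subsetExp (allPairs n) q W := by
    rw [erProb_eq_subsetExp, ← subsetExp_add,
      ← subsetExp_const (S := allPairs n) (p := q) 1]
    refine subsetExp_mono hq0 hq1 fun E hE => ?_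
    rw [subsetExp_const, hW]
    have h1 : 0 ≤ 1 / δ₁ ^ 2 * ((#E : ℝ) - #(allPairs n) * q) ^ 2 := by positivity
    have h2 : 0 ≤ ∑ v : Fin n, Real.exp (-(t * d)) * Real.exp (t * degOf E v) := by positivity
    have h3 : 0 ≤ 1 / δ₂ ^ 2 * (missProb n p E - a) ^ 2 := by positivity
    split_ifs with hgood
    · simp only
      linarith
    · simp only
      rw [not_and_or, not_and_or, not_le, not_le, not_le] at hgood
      rcases hgood with hg | hg | hg
      · rw [mul_comm, ← card_allPairs] at hg
        have := hcheb hδ₁ hg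
        linarith
      · obtain ⟨v, hv⟩ : ∃ v : Fin n, d < degOf E v := by
          by_contra! hall
          have : maxDeg E ≤ ⌊d⌋₊ := Finset.sup_le fun v _ => Nat.le_floor (hall v)
          exact hg.not_ge ((Nat.cast_le.2 this).trans (Nat.floor_le hd))
        have h4 : Real.exp (-(t * d)) * Real.exp (t * degOf E v) ≤
            ∑ v : Fin n, Real.exp (-(t * d)) * Real.exp (t * degOf E v) :=
          single_le_sum (f := fun v => Real.exp (-(t * d)) * Real.exp (t * degOf E v))
            (fun _ _ => by positivity) (mem_univ v)
        have h5 : 1 ≤ Real.exp (-(t * d)) * Real.exp (t * degOf E v) := by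
          rw [← Real.exp_add]
          exact Real.one_le_exp (by nlinarith)
        linarith
      · have := hcheb hδ₂ hg
        linarith
  linarith

/-- The second moment of the miss probability around its limit. -/
lemma subsetExp_missProb_sub_sq_le {n : ℕ} {q ν : ℝ} (hn : 0 < n) (hν : 0 < ν) (hq0 : 0 < q)
    (hq1 : q ≤ 1) (hp1 : 2 * ν ≤ q * n ^ 2) (hs : 1 ≤ √√(2 * ν / q)) :
    subsetExp (allPairs n) q
        (fun E => (missProb n √(2 * ν / (q * n ^ 2)) E - Real.exp (-ν)) ^ 2) ≤
      4 * ν ^ 2 / (q * n ^ 2) + (10 * ν / √√(2 * ν / q) + q * ν) ^ 2 := by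
  set p := √(2 * ν / (q * n ^ 2)) with hp
  set s := √√(2 * ν / q)
  have hn' : (0 : ℝ) < n := Nat.cast_pos.2 hn
  have hp0 : 0 ≤ p := Real.sqrt_nonneg _
  have hple : p ≤ 1 := by
    rw [hp, Real.sqrt_le_left zero_le_one, one_pow, div_le_one (by positivity)]
    exact hp1
  have hs2 : s ^ 2 = √(2 * ν / q) := Real.sq_sqrt (Real.sqrt_nonneg _)
  have hμ : n * p = s ^ 2 := by
    rw [hs2, hp, ← div_div, Real.sqrt_div (by positivity), Real.sqrt_sq hn'.le]
    field_simp
  have hs4 : q * s ^ 4 = 2 * ν := by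
    rw [show s ^ 4 = (s ^ 2) ^ 2 by ring, hs2, Real.sq_sqrt (by positivity)]
    field_simp
  have hp2 : p ^ 2 = 2 * ν / (q * n ^ 2) := Real.sq_sqrt (by positivity)
  have hmean := abs_subsetExp_missProb_sub_le hq0.le hq1 hp0 hple hs hμ hs4
  have hvar := subsetExp_missProb_sq_le n hq0.le hq1 hp0 hple
  have hchoose : (n.choose 2 : ℝ) ≤ n ^ 2 := by
    rw [Nat.cast_choose_two]
    nlinarith
  have hp4 : q * (n.choose 2 * p ^ 4) ≤ 4 * ν ^ 2 / (q * n ^ 2) := by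
    calc _ ≤ q * (n ^ 2 * p ^ 4) := by gcongr
      _ = q * (n ^ 2 * (p ^ 2) ^ 2) := by ring
      _ = _ := by
        rw [hp2]
        field_simp
        ring
  rw [subsetExp_sq_sub]
  refine add_le_add (by linarith) ?_
  rw [← sq_abs]
  gcongr

section asymptotics

variable {θ : ℝ} {q : ℕ → ℝ} {c₁ c₂ : ℝ}

lemma tendsto_edgeProb_zero (hθ1 : θ < 1) (hq0 : ∀ n, 0 ≤ q n)
    (hq : ∀ n : ℕ, q n ≤ c₂ * (n : ℝ) ^ (2 * (θ - 1))) : Tendsto q atTop (nhds 0) := by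
  refine squeeze_zero hq0 hq ?_
  have h := ((tendsto_rpow_neg_atTop (show 0 < 2 * (1 - θ) by linarith)).comp
    tendsto_natCast_atTop_atTop).const_mul c₂
  rw [mul_zero] at h
  refine h.congr fun n => ?_
  simp only [Function.comp]
  ring_nf

lemma tendsto_edgeProb_mul_sq_atTop (hθ0 : 0 < θ) (hc₁ : 0 < c₁)
    (hq : ∀ n : ℕ, c₁ * (n : ℝ) ^ (2 * (θ - 1)) ≤ q n) :
    Tendsto (fun n => q n * (n : ℝ) ^ 2) atTop atTop := by
  have h := ((tendsto_rpow_atTop (show 0 < 2 * θ by linarith)).comp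
    tendsto_natCast_atTop_atTop).const_mul_atTop hc₁
  refine tendsto_atTop_mono' _ ?_ h
  filter_upwards [eventually_gt_atTop 0] with n hn
  have hn' : (0 : ℝ) < n := Nat.cast_pos.2 hn
  calc c₁ * (n : ℝ) ^ (2 * θ) = c₁ * (n : ℝ) ^ (2 * (θ - 1)) * (n : ℝ) ^ 2 := by
        rw [mul_assoc, ← Real.rpow_natCast, ← Real.rpow_add hn']
        congr 2
        push_cast
        ring
    _ ≤ _ := mul_le_mul_of_nonneg_right (hq n) (by positivity)

lemma tendsto_kbar_atTop (hq0 : ∀ n, 0 ≤ q n)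
    (h : Tendsto (fun n => q n * (n : ℝ) ^ 2) atTop atTop) : Tendsto (kbar q) atTop atTop := by
  refine tendsto_atTop_mono' _ ?_ (h.atTop_div_const (show (0 : ℝ) < 4 by norm_num))
  filter_upwards [eventually_ge_atTop 2] with n hn
  have hn' : (2 : ℝ) ≤ n := by exact_mod_cast hn
  rw [kbar, Nat.cast_choose_two, mul_div_assoc]
  exact mul_le_mul_of_nonneg_left (by nlinarith) (hq0 n)

/-- The union bound for the degrees, `θ > 1/2`. -/
lemma tendsto_dense_degree_bound (hθ : 1 / 2 < θ) (hc₁ : 0 < c₁)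
    (hq : ∀ n : ℕ, c₁ * (n : ℝ) ^ (2 * (θ - 1)) ≤ q n) :
    Tendsto (fun n : ℕ => (n : ℝ) * (Real.exp (q n * (Real.exp 1 - 1) * n) *
      Real.exp (-(1 * (2 * (n : ℝ) * q n))))) atTop (nhds 0) := by
  have he : 0 < 3 - Real.exp 1 := by linarith [Real.exp_one_lt_d9]
  have hr : 0 < 2 * θ - 1 := by linarith
  have h := (tendsto_rpow_mul_exp_neg_mul_atTop_nhds_zero (1 / (2 * θ - 1))
    ((3 - Real.exp 1) * c₁) (by positivity)).comp
    ((tendsto_rpow_atTop hr).comp tendsto_natCast_atTop_atTop)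
  refine squeeze_zero' (Eventually.of_forall fun n => by positivity) ?_ h
  filter_upwards [eventually_gt_atTop 0] with n hn
  have hn' : (0 : ℝ) < n := Nat.cast_pos.2 hn
  simp only [Function.comp]
  rw [← Real.rpow_mul hn'.le, mul_one_div_cancel hr.ne', Real.rpow_one, ← Real.exp_add]
  refine mul_le_mul_of_nonneg_left (Real.exp_le_exp.2 ?_) hn'.le
  have h1 : c₁ * (n : ℝ) ^ (2 * θ - 1) ≤ q n * n := by
    calc _ = c₁ * (n : ℝ) ^ (2 * (θ - 1)) * n := by
          rw [mul_assoc, ← Real.rpow_add_one hn'.ne']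
          ring_nf
      _ ≤ _ := mul_le_mul_of_nonneg_right (hq n) hn'.le
  nlinarith [mul_le_mul_of_nonneg_left h1 he.le]

/-- The union bound for the degrees, `θ ≤ 1/2`. -/
lemma tendsto_sparse_degree_bound (hθ : θ ≤ 1 / 2)
    (hq0 : ∀ n, 0 ≤ q n) (hq : ∀ n : ℕ, q n ≤ c₂ * (n : ℝ) ^ (2 * (θ - 1))) :
    Tendsto (fun n : ℕ => (n : ℝ) * (Real.exp (q n * (Real.exp 2 - 1) * n) *
      Real.exp (-(2 * Real.log n)))) atTop (nhds 0) := by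
  have hc₂ : 0 ≤ c₂ := by simpa using (hq0 1).trans (hq 1)
  refine squeeze_zero' (Eventually.of_forall fun n => by positivity) ?_
    (tendsto_const_div_atTop_nhds_zero_nat (Real.exp (c₂ * (Real.exp 2 - 1))))
  filter_upwards [eventually_gt_atTop 0] with n hn
  have hn' : (0 : ℝ) < n := Nat.cast_pos.2 hn
  have h1 : q n * n ≤ c₂ := by
    calc _ ≤ c₂ * (n : ℝ) ^ (2 * (θ - 1)) * n := mul_le_mul_of_nonneg_right (hq n) hn'.le
      _ = c₂ * (n : ℝ) ^ (2 * θ - 1) := by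
          rw [mul_assoc, ← Real.rpow_add_one hn'.ne']
          ring_nf
      _ ≤ c₂ * 1 := by
          refine mul_le_mul_of_nonneg_left ?_ hc₂
          exact Real.rpow_le_one_of_one_le_of_nonpos (by exact_mod_cast hn) (by linarith)
      _ = c₂ := mul_one _
  have he : 0 ≤ Real.exp 2 - 1 := sub_nonneg.2 (Real.one_le_exp (by norm_num))
  have h2 : Real.exp (-(2 * Real.log n)) = 1 / (n : ℝ) ^ 2 := by
    rw [Real.exp_neg, ← Real.log_rpow hn', Real.exp_log (by positivity), one_div]
    norm_cast
  rw [h2]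
  calc _ ≤ (n : ℝ) * (Real.exp (c₂ * (Real.exp 2 - 1)) * (1 / (n : ℝ) ^ 2)) := by
        gcongr _ * (Real.exp ?_ * _)
        nlinarith [mul_le_mul_of_nonneg_right h1 he]
    _ = _ := by field_simp

end asymptotics

/-- typicality, Lemma 1.
Fix `θ ∈ (0,1)` and `q = Θ(n^{2(θ−1)})`, let `G ~ ER(n,q)` with `k̄ = q·C(n,2)`, and let
Bernoulli(p) testing use `p = √(2ν/(q n²))` for a fixed `ν > 0`.  With
`d_max = 2nq` if `θ > 1/2` and `d_max = log n` if `θ ≤ 1/2`, there is a sequence `ε_n → 0`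
such that, with probability tending to one, `G` satisfies: (i) `(1−ε_n)k̄ ≤ |E(G)| ≤ (1+ε_n)k̄`;
(ii) the maximum degree of `G` is at most `d_max`; (iii)
`(1−ε_n)(1−e^{−ν}) ≤ P_G[Y=1] ≤ (1+ε_n)(1−e^{−ν})`. -/
theorem statement5
    (θ : ℝ) (hθ0 : 0 < θ) (hθ1 : θ < 1)
    (ν : ℝ) (hν : 0 < ν)
    (q : ℕ → ℝ) (hq01 : ∀ n, 0 ≤ q n ∧ q n ≤ 1)
    (c₁ c₂ : ℝ) (hc₁ : 0 < c₁)
    (hq : ∀ n : ℕ, c₁ * (n : ℝ) ^ (2 * (θ - 1)) ≤ q n ∧ q n ≤ c₂ * (n : ℝ) ^ (2 * (θ - 1))) :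
    ∃ ε : ℕ → ℝ, Tendsto ε atTop (nhds 0) ∧
      Tendsto (fun n => erProb n (q n) (fun E =>
          ((1 - ε n) * kbar q n ≤ (E.card : ℝ) ∧ (E.card : ℝ) ≤ (1 + ε n) * kbar q n) ∧
          (maxDeg E : ℝ) ≤ (if (1 : ℝ) / 2 < θ then 2 * (n : ℝ) * q n else Real.log n) ∧
          ((1 - ε n) * (1 - Real.exp (-ν)) ≤
              bernProb n (Real.sqrt (2 * ν / (q n * (n : ℝ) ^ 2))) (covers E) ∧
            bernProb n (Real.sqrt (2 * ν / (q n * (n : ℝ) ^ 2))) (covers E) ≤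
              (1 + ε n) * (1 - Real.exp (-ν)))))
        atTop (nhds 1) := by
  obtain ⟨hqlo, hqhi⟩ := forall_and.1 hq
  obtain ⟨hq0, hq1⟩ := forall_and.1 hq01
  have hqlim := tendsto_edgeProb_zero hθ1 hq0 hqhi
  have hmlim := tendsto_edgeProb_mul_sq_atTop hθ0 hc₁ hqlo
  have hklim := tendsto_kbar_atTop hq0 hmlim
  have hqpos : ∀ᶠ n in atTop, 0 < q n := by
    filter_upwards [eventually_gt_atTop 0] with n hn
    have hn' : (0 : ℝ) < n := Nat.cast_pos.2 hn
    exact lt_of_lt_of_le (by positivity) (hqlo n)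
  set s : ℕ → ℝ := fun n => √√(2 * ν / q n)
  have hslim : Tendsto s atTop atTop := by
    have hinv : Tendsto (fun n => (q n)⁻¹) atTop atTop :=
      tendsto_inv_nhdsGT_zero.comp (tendsto_nhdsWithin_iff.2 ⟨hqlim, hqpos⟩)
    exact Real.tendsto_sqrt_atTop.comp (Real.tendsto_sqrt_atTop.comp
      (hinv.const_mul_atTop (show 0 < 2 * ν by positivity)))
  set V : ℕ → ℝ := fun n =>
    4 * ν ^ 2 / (q n * (n : ℝ) ^ 2) + (10 * ν / s n + q n * ν) ^ 2 with hV
  have hVlim : Tendsto V atTop (nhds 0) := by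
    have h := (hmlim.const_div_atTop (4 * ν ^ 2)).add
      (((hslim.const_div_atTop (10 * ν)).add (hqlim.mul_const ν)).pow 2)
    simpa using h
  have hVroot : Tendsto (fun n => V n ^ (1 / 4 : ℝ)) atTop (nhds 0) := by
    simpa using hVlim.rpow_const (p := (1 / 4 : ℝ)) (Or.inr (by norm_num))
  have hVsqrt : Tendsto (fun n => V n ^ (1 / 2 : ℝ)) atTop (nhds 0) := by
    simpa using hVlim.rpow_const (p := (1 / 2 : ℝ)) (Or.inr (by norm_num))
  have hkroot : Tendsto (fun n => kbar q n ^ (-(1 / 4) : ℝ)) atTop (nhds 0) :=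
    (tendsto_rpow_neg_atTop (by norm_num)).comp hklim
  have hksqrt : Tendsto (fun n => kbar q n ^ (-(1 / 2) : ℝ)) atTop (nhds 0) :=
    (tendsto_rpow_neg_atTop (by norm_num)).comp hklim
  set a := Real.exp (-ν)
  have ha1 : 0 < 1 - a := sub_pos.2 (Real.exp_lt_one_iff.2 (by linarith))
  obtain ⟨t, ht, hDlim⟩ : ∃ t : ℝ, 0 ≤ t ∧ Tendsto (fun n : ℕ => (n : ℝ) *
      (Real.exp (q n * (Real.exp t - 1) * n) * Real.exp (-(t *
        (if (1 : ℝ) / 2 < θ then 2 * (n : ℝ) * q n else Real.log n))))) atTop (nhds 0) := by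
    by_cases hθ : (1 : ℝ) / 2 < θ
    · exact ⟨1, zero_le_one, by simpa only [if_pos hθ] using tendsto_dense_degree_bound hθ hc₁ hqlo⟩
    · exact ⟨2, zero_le_two, by
        simpa only [if_neg hθ] using tendsto_sparse_degree_bound (not_lt.1 hθ) hq0 hqhi⟩
  refine ⟨fun n => kbar q n ^ (-(1 / 4) : ℝ) + V n ^ (1 / 4 : ℝ) / (1 - a), ?_, ?_⟩
  · simpa using hkroot.add (hVroot.div_const (1 - a))
  have hlow := tendsto_const_nhds (x := (1 : ℝ)).sub ((hksqrt.add hDlim).add hVsqrt)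
  rw [add_zero, add_zero, sub_zero] at hlow
  refine tendsto_of_tendsto_of_tendsto_of_le_of_le' hlow tendsto_const_nhds ?_
    (Eventually.of_forall fun n => erProb_le_one (hq0 n) (hq1 n) _)
  filter_upwards [eventually_gt_atTop 0, hqpos, hmlim.eventually_ge_atTop (2 * ν),
    hslim.eventually_ge_atTop 1, hklim.eventually_gt_atTop 0] with n hn hqn hm hsn hk
  have hn' : (1 : ℝ) ≤ n := by exact_mod_cast hn
  have hVn : 0 < V n := by
    have : (0 : ℝ) < n := by linarith
    have : 0 < s n := by linarith
    simp only [hV]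
    positivity
  have hd : 0 ≤ (if (1 : ℝ) / 2 < θ then 2 * (n : ℝ) * q n else Real.log n) := by
    split_ifs
    · positivity
    · exact Real.log_nonneg hn'
  have hδ₁ : kbar q n / (kbar q n ^ (3 / 4 : ℝ)) ^ 2 = kbar q n ^ (-(1 / 2) : ℝ) := by
    rw [← Real.rpow_mul_natCast hk.le]
    nth_rewrite 1 [← Real.rpow_one (kbar q n)]
    rw [← Real.rpow_sub hk]
    norm_num
  have hδ₂ : V n / (V n ^ (1 / 4 : ℝ)) ^ 2 = V n ^ (1 / 2 : ℝ) := by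
    rw [← Real.rpow_mul_natCast hVn.le]
    nth_rewrite 1 [← Real.rpow_one (V n)]
    rw [← Real.rpow_sub hVn]
    norm_num
  have hprob := one_sub_le_erProb_typical (hq0 n) (hq1 n) ht hd
    (Real.rpow_pos_of_pos hk (3 / 4)) (Real.rpow_pos_of_pos hVn (1 / 4))
    (subsetExp_missProb_sub_sq_le hn hν hqn (hq1 n) hm hsn)
  rw [← kbar, hδ₁, hδ₂] at hprob
  refine hprob.trans (erProb_mono (hq0 n) (hq1 n) fun E hE => ?_)
  rintro ⟨hcard, hdeg, hmiss⟩
  rw [bernProb_covers n _ hE]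
  have hkroot_mul : kbar q n ^ (-(1 / 4) : ℝ) * kbar q n = kbar q n ^ (3 / 4 : ℝ) := by
    rw [← Real.rpow_add_one hk.ne']
    norm_num
  have hVroot_mul : V n ^ (1 / 4 : ℝ) / (1 - a) * (1 - a) = V n ^ (1 / 4 : ℝ) :=
    div_mul_cancel₀ _ ha1.ne'
  have h1 : 0 ≤ V n ^ (1 / 4 : ℝ) / (1 - a) * kbar q n := by positivity
  have h2 : 0 ≤ kbar q n ^ (-(1 / 4) : ℝ) * (1 - a) := by positivity
  rw [abs_le] at hcard hmiss
  refine ⟨⟨?_, ?_⟩, hdeg, ?_, ?_⟩ <;> nlinarith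

end
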